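/- arXiv:0709.0910 — 2 statements merged into one kernel-verified Lean document; each statement's English description precedes it below -/
import Mathlib

section
/- Let n ≥ 4 and let π be a permutation of [n]. Then the number of subsets U ⊆ [n] with 1 ∈ U, U ≠ [n], such that neither U nor its complement [n]∖U is over the ridge from π, equals 2^{n−1} − n. (Since each unordered complementary pair {U, [n]∖U} of nonempty proper subsets has exactly one member containing 1, and such pairs are in bijection with the unbounded edges of closure(Q_n) through the vertex M(π), this is the number of unbounded edges issuing from a vertex of closure(Q_n).) -/
open scoped BigOperators Pointwise

noncomputable def mmap {n : ℕ} (x : Fin n → ℝ) : Matrix (Fin n) (Fin n) ℝ :=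
  fun k l => |x k - x l|

noncomputable def chi {n : ℕ} (U : Finset (Fin n)) : Fin n → ℝ :=
  fun j => if j ∈ U then 1 else 0

noncomputable def permVec {n : ℕ} (π : Equiv.Perm (Fin n)) : Fin n → ℝ :=
  fun j => ((π j : ℕ) : ℝ) + 1

noncomputable def Mperm {n : ℕ} (π : Equiv.Perm (Fin n)) : Matrix (Fin n) (Fin n) ℝ :=
  mmap (permVec π)

def Npi {n : ℕ} (π : Equiv.Perm (Fin n)) : Set (Fin n → ℝ) :=
  {x | (∑ k, x k) = 0 ∧ ∀ k l : Fin n, π k < π l → x k ≤ x l}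

def Ebn (n : ℕ) : Set (Matrix (Fin n) (Fin n) ℝ) :=
  {X | ∃ x : Fin n → ℝ, (∀ k l : Fin n, k ≠ l → 1 ≤ |x k - x l|) ∧ X = mmap x}

noncomputable def Qn (n : ℕ) : Set (Matrix (Fin n) (Fin n) ℝ) :=
  convexHull ℝ (Ebn n)

noncomputable def Pn (n : ℕ) : Set (Matrix (Fin n) (Fin n) ℝ) :=
  convexHull ℝ {X | ∃ π : Equiv.Perm (Fin n), X = Mperm π}

noncomputable def cutCone (n : ℕ) : Set (Matrix (Fin n) (Fin n) ℝ) :=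
  {X | ∃ lam : Finset (Fin n) → ℝ, (∀ U, 0 ≤ lam U) ∧
    X = ∑ U : Finset (Fin n), lam U • mmap (chi U)}

def incident {n : ℕ} (π : Equiv.Perm (Fin n)) (U : Finset (Fin n)) : Prop :=
  U.Nonempty ∧ U ≠ Finset.univ ∧ ∀ j, j ∈ U ↔ (π j : ℕ) + 1 ≤ U.card

def overRidge {n : ℕ} (π : Equiv.Perm (Fin n)) (V : Finset (Fin n)) : Prop :=
  ∃ k : ℕ, 1 ≤ k ∧ k ≤ n - 1 ∧
    ∀ j, j ∈ V ↔ ((π j : ℕ) + 1 ≤ k - 1 ∨ (π j : ℕ) + 1 = k + 1)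

noncomputable def halfline {n : ℕ} (π : Equiv.Perm (Fin n)) (U : Finset (Fin n)) :
    Set (Matrix (Fin n) (Fin n) ℝ) :=
  {X | ∃ t : ℝ, 0 ≤ t ∧ X = Mperm π + t • mmap (chi U)}

noncomputable def antipode {n : ℕ} (π : Equiv.Perm (Fin n)) : Equiv.Perm (Fin n) :=
  π.trans Fin.revPerm

/-- The set over the ridge with (0-based) index `a`. -/
def ridgeSet {n : ℕ} (π : Equiv.Perm (Fin n)) (a : ℕ) : Finset (Fin n) :=
  Finset.univ.filter (fun j => (π j : ℕ) < a ∨ (π j : ℕ) = a + 1)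

lemma overRidge_iff {n : ℕ} (hn : 4 ≤ n) (π : Equiv.Perm (Fin n)) (V : Finset (Fin n)) :
    overRidge π V ↔ ∃ a ∈ Finset.range (n - 1), V = ridgeSet π a := by
  constructor
  · rintro ⟨k, h1, h2, h⟩
    refine ⟨k - 1, Finset.mem_range.2 (by omega), ?_⟩
    ext j
    simp only [ridgeSet, Finset.mem_filter, Finset.mem_univ, true_and, h j]
    omega
  · rintro ⟨a, ha, rfl⟩
    have := Finset.mem_range.1 ha
    refine ⟨a + 1, by omega, by omega, fun j => ?_⟩
    simp only [ridgeSet, Finset.mem_filter, Finset.mem_univ, true_and]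
    omega

lemma mem_ridge_symm {n : ℕ} (π : Equiv.Perm (Fin n)) (a p : ℕ) (hp : p < n) :
    π.symm ⟨p, hp⟩ ∈ ridgeSet π a ↔ (p < a ∨ p = a + 1) := by
  simp [ridgeSet]

lemma ridge_inj {n : ℕ} (π : Equiv.Perm (Fin n)) (a b : ℕ) (ha : a < n - 1) (hb : b < n - 1)
    (h : ridgeSet π a = ridgeSet π b) : a = b := by
  have h1 := mem_ridge_symm π a a (by omega)
  have h2 := mem_ridge_symm π b a (by omega)
  have h3 := mem_ridge_symm π a b (by omega)
  have h4 := mem_ridge_symm π b b (by omega)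
  rw [h] at h1 h3
  rw [h1] at h2
  rw [h3] at h4
  omega

lemma ridge_ne_compl {n : ℕ} (hn : 4 ≤ n) (π : Equiv.Perm (Fin n)) (a b : ℕ) :
    ridgeSet π a ≠ (ridgeSet π b)ᶜ := by
  intro h
  have key : ∀ p, p < n → ((p < a ∨ p = a + 1) ↔ ¬ (p < b ∨ p = b + 1)) := by
    intro p hp
    rw [← mem_ridge_symm π a p hp, ← mem_ridge_symm π b p hp, h, Finset.mem_compl]
  have h0 := key 0 (by omega)
  have h1 := key 1 (by omega)
  have h2 := key 2 (by omega)
  have h3 := key 3 (by omega)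
  omega

lemma ridge_ne_univ {n : ℕ} (π : Equiv.Perm (Fin n)) (a : ℕ) (ha : a < n - 1) :
    ridgeSet π a ≠ Finset.univ := by
  intro h
  have := mem_ridge_symm π a a (by omega)
  rw [h] at this
  simp at this

lemma ridge_ne_empty {n : ℕ} (π : Equiv.Perm (Fin n)) (a : ℕ) (ha : a < n - 1) :
    ridgeSet π a ≠ ∅ := by
  intro h
  have := mem_ridge_symm π a (a + 1) (by omega)
  rw [h] at this
  simp at this

/-- The member containing `z` of the complementary pair. -/
def ridgeRep {n : ℕ} (π : Equiv.Perm (Fin n)) (z : Fin n) (a : ℕ) : Finset (Fin n) :=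
  if z ∈ ridgeSet π a then ridgeSet π a else (ridgeSet π a)ᶜ

lemma mem_ridgeRep {n : ℕ} (π : Equiv.Perm (Fin n)) (z : Fin n) (a : ℕ) :
    z ∈ ridgeRep π z a := by
  unfold ridgeRep
  split_ifs with h
  · exact h
  · simpa using h

lemma eq_ridgeRep {n : ℕ} (π : Equiv.Perm (Fin n)) (z : Fin n) (a : ℕ) (U : Finset (Fin n))
    (hz : z ∈ U) : U = ridgeRep π z a ↔ (U = ridgeSet π a ∨ Uᶜ = ridgeSet π a) := by
  have hc : Uᶜ = ridgeSet π a ↔ U = (ridgeSet π a)ᶜ := compl_eq_comm.trans eq_comm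
  rw [hc]
  unfold ridgeRep
  split_ifs with h
  · refine ⟨Or.inl, fun h' => h'.resolve_right ?_⟩
    rintro rfl
    simp at hz
    exact hz h
  · refine ⟨Or.inr, fun h' => h'.resolve_left ?_⟩
    rintro rfl
    exact h hz

lemma ridgeRep_inj {n : ℕ} (hn : 4 ≤ n) (π : Equiv.Perm (Fin n)) (z : Fin n) (a b : ℕ)
    (ha : a < n - 1) (hb : b < n - 1) (h : ridgeRep π z a = ridgeRep π z b) : a = b := by
  unfold ridgeRep at h
  split_ifs at h
  · exact ridge_inj π a b ha hb h
  · exact absurd h (ridge_ne_compl hn π a b)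
  · exact absurd h.symm (ridge_ne_compl hn π b a)
  · exact ridge_inj π a b ha hb (compl_injective h)

lemma ridgeRep_ne_univ {n : ℕ} (π : Equiv.Perm (Fin n)) (z : Fin n) (a : ℕ)
    (ha : a < n - 1) : ridgeRep π z a ≠ Finset.univ := by
  unfold ridgeRep
  split_ifs
  · exact ridge_ne_univ π a ha
  · intro h
    exact ridge_ne_empty π a ha (by simpa using h)

open Classical in
theorem stmt18 (n : ℕ) (hn : 4 ≤ n) (π : Equiv.Perm (Fin n)) :
    ((Finset.univ : Finset (Finset (Fin n))).filter (fun U =>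
        (⟨0, by omega⟩ : Fin n) ∈ U ∧ U ≠ Finset.univ ∧
        ¬ overRidge π U ∧ ¬ overRidge π Uᶜ)).card = 2 ^ (n - 1) - n := by
  set z : Fin n := ⟨0, by omega⟩ with hz
  have hset : ((Finset.univ : Finset (Finset (Fin n))).filter (fun U =>
        z ∈ U ∧ U ≠ Finset.univ ∧ ¬ overRidge π U ∧ ¬ overRidge π Uᶜ)) =
      Finset.Icc {z} Finset.univ \
        insert Finset.univ ((Finset.range (n - 1)).image (ridgeRep π z)) := by
    ext U
    simp only [Finset.mem_filter, Finset.mem_univ, true_and, Finset.mem_sdiff, Finset.mem_Icc,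
      Finset.le_eq_subset, Finset.singleton_subset_iff, Finset.subset_univ, and_true,
      Finset.mem_insert, Finset.mem_image, not_or]
    refine and_congr_right fun hU => and_congr_right fun _ => ?_
    rw [← not_or, not_iff_not, overRidge_iff hn, overRidge_iff hn]
    constructor
    · rintro (⟨a, ha, h⟩ | ⟨a, ha, h⟩)
      · exact ⟨a, ha, ((eq_ridgeRep π z a U hU).2 (Or.inl h)).symm⟩
      · exact ⟨a, ha, ((eq_ridgeRep π z a U hU).2 (Or.inr h)).symm⟩
    · rintro ⟨a, ha, h⟩
      rcases (eq_ridgeRep π z a U hU).1 h.symm with h | h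
      · exact Or.inl ⟨a, ha, h⟩
      · exact Or.inr ⟨a, ha, h⟩
  rw [hset, Finset.card_sdiff_of_subset, Finset.card_Icc_finset (Finset.subset_univ _),
    Finset.card_insert_of_notMem, Finset.card_image_of_injOn]
  · simp only [Finset.card_univ, Fintype.card_fin, Finset.card_singleton, Finset.card_range]
    congr 1
    omega
  · intro a ha b hb h
    simp only [Finset.coe_range, Set.mem_Iio] at ha hb
    exact ridgeRep_inj hn π z a b ha hb h
  · intro h
    obtain ⟨a, ha, h⟩ := Finset.mem_image.1 h
    exact ridgeRep_ne_univ π z a (Finset.mem_range.1 ha) h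
  · intro U hU
    simp only [Finset.mem_Icc, Finset.le_eq_subset, Finset.singleton_subset_iff,
      Finset.subset_univ, and_true]
    rcases Finset.mem_insert.1 hU with rfl | hU
    · exact Finset.mem_univ _
    · obtain ⟨a, _, rfl⟩ := Finset.mem_image.1 hU
      exact mem_ridgeRep π z a
end

section
/- Let n ≥ 3. The convex set Q_n is closed (in the space of n×n real matrices) if and only if n ≤ 3, i.e., Q_3 is closed and Q_n is not closed for every n ≥ 4. -/
open scoped BigOperators Pointwise

def Tm (u v w : ℝ) : Matrix (Fin 3) (Fin 3) ℝ :=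
  !![0, u + v, u + w; u + v, 0, v + w; u + w, v + w, 0]

def P3 : Set (Matrix (Fin 3) (Fin 3) ℝ) :=
  {X | (X 0 0 = 0 ∧ X 1 1 = 0 ∧ X 2 2 = 0 ∧ X 1 0 = X 0 1 ∧ X 2 0 = X 0 2 ∧ X 2 1 = X 1 2) ∧
    (1 ≤ X 0 1 ∧ 1 ≤ X 0 2 ∧ 1 ≤ X 1 2) ∧
    (X 0 1 ≤ X 0 2 + X 1 2 ∧ X 0 2 ≤ X 0 1 + X 1 2 ∧ X 1 2 ≤ X 0 1 + X 0 2) ∧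
    4 ≤ X 0 1 + X 0 2 + X 1 2}

lemma P3_closed : IsClosed P3 := by
  have hc : ∀ i j : Fin 3, Continuous (fun X : Matrix (Fin 3) (Fin 3) ℝ => X i j) :=
    fun i j => continuous_id.matrix_elem i j
  unfold P3
  simp only [Set.ofPred_and]
  repeat' apply IsClosed.inter
  all_goals first
    | apply isClosed_eq
    | apply isClosed_le
  all_goals first
    | exact hc _ _
    | exact continuous_const
    | exact (hc _ _).add (hc _ _)
    | exact ((hc _ _).add (hc _ _)).add (hc _ _)

lemma P3_convex : Convex ℝ P3 := by
  rintro X ⟨⟨h1, h2, h3, h4, h5, h6⟩, ⟨h7, h8, h9⟩, ⟨h10, h11, h12⟩, h13⟩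
    Y ⟨⟨k1, k2, k3, k4, k5, k6⟩, ⟨k7, k8, k9⟩, ⟨k10, k11, k12⟩, k13⟩ a b ha hb hab
  simp only [P3, Set.mem_ofPred_eq, Matrix.add_apply, Matrix.smul_apply, smul_eq_mul]
  refine ⟨⟨?_, ?_, ?_, ?_, ?_, ?_⟩, ⟨?_, ?_, ?_⟩, ⟨?_, ?_, ?_⟩, ?_⟩
  · rw [h1, k1]; ring
  · rw [h2, k2]; ring
  · rw [h3, k3]; ring
  · rw [h4, k4]
  · rw [h5, k5]
  · rw [h6, k6]
  all_goals nlinarith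

lemma Ebn3_sub : Ebn 3 ⊆ P3 := by
  rintro X ⟨x, hx, rfl⟩
  have h01 := hx 0 1 (by decide)
  have h02 := hx 0 2 (by decide)
  have h12 := hx 1 2 (by decide)
  simp only [P3, Set.mem_ofPred_eq, mmap]
  refine ⟨⟨by simp, by simp, by simp, abs_sub_comm _ _, abs_sub_comm _ _, abs_sub_comm _ _⟩,
    ⟨h01, h02, h12⟩, ?_⟩
  rcases abs_cases (x 0 - x 1) with ⟨e1, _⟩ | ⟨e1, _⟩ <;>
  rcases abs_cases (x 0 - x 2) with ⟨e2, _⟩ | ⟨e2, _⟩ <;>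
  rcases abs_cases (x 1 - x 2) with ⟨e3, _⟩ | ⟨e3, _⟩ <;>
  rw [e1] at h01 ⊢ <;> rw [e2] at h02 ⊢ <;> rw [e3] at h12 ⊢ <;>
  refine ⟨⟨?_, ?_, ?_⟩, ?_⟩ <;> linarith

lemma mem_E_aux (x : Fin 3 → ℝ) (X : Matrix (Fin 3) (Fin 3) ℝ) (h : X = mmap x)
    (h01 : 1 ≤ X 0 1) (h02 : 1 ≤ X 0 2) (h12 : 1 ≤ X 1 2) : X ∈ Ebn 3 := by
  subst h
  refine ⟨x, ?_, rfl⟩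
  simp only [mmap] at h01 h02 h12
  intro k l hkl
  fin_cases k <;> fin_cases l <;> simp at hkl ⊢ <;>
    first | assumption | (rw [abs_sub_comm]; assumption)

lemma Tm0 {v w : ℝ} (hv : 1 ≤ v) (hw : 1 ≤ w) : Tm 0 v w ∈ Ebn 3 := by
  refine mem_E_aux ![0, v, -w] _ ?_ ?_ ?_ ?_
  · ext i j
    fin_cases i <;> fin_cases j <;> simp [Tm, mmap] <;> symm
    all_goals first
      | (rw [abs_of_nonneg (by linarith)]; done)
      | (rw [abs_of_nonneg (by linarith)]; ring; done)
      | (rw [abs_of_nonpos (by linarith)]; ring)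
  all_goals simp [Tm]; linarith

lemma Tm1 {v w : ℝ} (hv : 1 ≤ v) (hw : 1 ≤ w) : Tm v 0 w ∈ Ebn 3 := by
  refine mem_E_aux ![v, 0, -w] _ ?_ ?_ ?_ ?_
  · ext i j
    fin_cases i <;> fin_cases j <;> simp [Tm, mmap] <;> symm
    all_goals first
      | (rw [abs_of_nonneg (by linarith)]; done)
      | (rw [abs_of_nonneg (by linarith)]; ring; done)
      | (rw [abs_of_nonpos (by linarith)]; ring)
  all_goals simp [Tm]; linarith

lemma Tm2 {v w : ℝ} (hv : 1 ≤ v) (hw : 1 ≤ w) : Tm v w 0 ∈ Ebn 3 := by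
  refine mem_E_aux ![v, -w, 0] _ ?_ ?_ ?_ ?_
  · ext i j
    fin_cases i <;> fin_cases j <;> simp [Tm, mmap] <;> symm
    all_goals first
      | (rw [abs_of_nonneg (by linarith)]; done)
      | (rw [abs_of_nonneg (by linarith)]; ring; done)
      | (rw [abs_of_nonpos (by linarith)]; ring)
  all_goals simp [Tm]; linarith

lemma weights {u v w : ℝ} (hu : 0 < u) (hv : 0 < v) (hw : 0 < w) (h1 : 1 ≤ u + v)
    (h2 : 1 ≤ u + w) (h3 : 1 ≤ v + w) (h : 2 ≤ u + v + w) :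
    ∃ a b c : ℝ, 0 ≤ a ∧ 0 ≤ b ∧ 0 ≤ c ∧ a + b + c = 1 ∧ a < 1 ∧ b < 1 ∧ c < 1 ∧
      1 - a ≤ u ∧ 1 - b ≤ v ∧ 1 - c ≤ w := by
  have key : ∀ p q r : ℝ, 0 ≤ p → 0 ≤ q → 0 ≤ r → p < 1 → q < 1 → r < 1 → 1 - p ≤ u →
      1 - q ≤ v → 1 - r ≤ w → p + q + r ≤ 1 → 
      ∃ a b c : ℝ, 0 ≤ a ∧ 0 ≤ b ∧ 0 ≤ c ∧ a + b + c = 1 ∧ a < 1 ∧ b < 1 ∧ c < 1 ∧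
      1 - a ≤ u ∧ 1 - b ≤ v ∧ 1 - c ≤ w := by
    intro p q r _ _ _ _ _ _ _ _ _ _
    refine ⟨p + (1 - p - q - r) / 3, q + (1 - p - q - r) / 3, r + (1 - p - q - r) / 3, ?_⟩
    refine ⟨?_, ?_, ?_, ?_, ?_, ?_, ?_, ?_, ?_, ?_⟩ <;> linarith
  apply key (max 0 (1 - u)) (max 0 (1 - v)) (max 0 (1 - w))
  all_goals
    rcases max_cases 0 (1 - u) with ⟨e1, _⟩ | ⟨e1, _⟩ <;>
    rcases max_cases 0 (1 - v) with ⟨e2, _⟩ | ⟨e2, _⟩ <;>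
    rcases max_cases 0 (1 - w) with ⟨e3, _⟩ | ⟨e3, _⟩ <;>
    simp only [e1, e2, e3] <;> linarith

lemma Tm_mem {u v w : ℝ} (hu : 0 ≤ u) (hv : 0 ≤ v) (hw : 0 ≤ w) (h1 : 1 ≤ u + v)
    (h2 : 1 ≤ u + w) (h3 : 1 ≤ v + w) (h : 2 ≤ u + v + w) : Tm u v w ∈ Qn 3 := by
  have sub : Ebn 3 ⊆ Qn 3 := subset_convexHull ℝ _
  rcases hu.eq_or_lt with rfl | hu
  · exact sub (Tm0 (by linarith) (by linarith))
  rcases hv.eq_or_lt with rfl | hv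
  · exact sub (Tm1 (by linarith) (by linarith))
  rcases hw.eq_or_lt with rfl | hw
  · exact sub (Tm2 (by linarith) (by linarith))
  obtain ⟨a, b, c, ha, hb, hc, habc, ha1, hb1, hc1, hau, hbv, hcw⟩ := weights hu hv hw h1 h2 h3 h
  have hU : 1 ≤ u / (1 - a) := by rw [le_div_iff₀] <;> linarith
  have hV : 1 ≤ v / (1 - b) := by rw [le_div_iff₀] <;> linarith
  have hW : 1 ≤ w / (1 - c) := by rw [le_div_iff₀] <;> linarith
  have eU : u = (1 - a) * (u / (1 - a)) := by rw [mul_div_cancel₀]; linarith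
  have eV : v = (1 - b) * (v / (1 - b)) := by rw [mul_div_cancel₀]; linarith
  have eW : w = (1 - c) * (w / (1 - c)) := by rw [mul_div_cancel₀]; linarith
  generalize u / (1 - a) = U at *
  generalize v / (1 - b) = V at *
  generalize w / (1 - c) = W at *
  have hconv : Convex ℝ (Qn 3) := convex_convexHull ℝ _
  have := hconv.sum_mem (t := Finset.univ) (w := ![a, b, c])
    (z := ![Tm 0 V W, Tm U 0 W, Tm U V 0])
    (by intro i _; fin_cases i <;> simpa) (by simp [Fin.sum_univ_three, habc])
    (by
      intro i _
      fin_cases i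
      · exact sub (Tm0 hV hW)
      · exact sub (Tm1 hU hW)
      · exact sub (Tm2 hU hV))
  convert this using 1
  have ea : a = 1 - b - c := by linarith
  rw [Fin.sum_univ_three]
  ext i j
  fin_cases i <;> fin_cases j <;> simp [Tm] <;> simp only [eU, eV, eW] <;> subst ea <;> ring
  
lemma Q3_eq : Qn 3 = P3 := by
  apply subset_antisymm
  · exact convexHull_min Ebn3_sub P3_convex
  · rintro X ⟨⟨h1, h2, h3, h4, h5, h6⟩, ⟨h7, h8, h9⟩, ⟨h10, h11, h12⟩, h13⟩
    have : X = Tm ((X 0 1 + X 0 2 - X 1 2) / 2) ((X 0 1 + X 1 2 - X 0 2) / 2)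
        ((X 0 2 + X 1 2 - X 0 1) / 2) := by
      ext i j
      fin_cases i <;> fin_cases j <;> simp [Tm] <;> linarith
    rw [this]
    apply Tm_mem <;> linarith

lemma mmap_cont {n : ℕ} : Continuous (mmap : (Fin n → ℝ) → _) := by
  refine continuous_matrix fun i j => ?_
  exact ((continuous_apply i).sub (continuous_apply j)).abs

lemma mmap_smul {n : ℕ} (e : ℝ) (he : 0 ≤ e) (x : Fin n → ℝ) : mmap (e • x) = e • mmap x := by
  ext i j
  simp [mmap, ← mul_sub, abs_mul, abs_of_nonneg he]

lemma idx_dist {n : ℕ} {k l : Fin n} (h : k ≠ l) : (1 : ℝ) ≤ |((k : ℕ) : ℝ) - ((l : ℕ) : ℝ)| := by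
  have h' : (k : ℕ) ≠ l := fun e => h (Fin.ext e)
  rcases lt_or_gt_of_ne h' with h' | h'
  · have : ((k : ℕ) : ℝ) + 1 ≤ ((l : ℕ) : ℝ) := by exact_mod_cast h'
    rw [abs_of_nonpos] <;> linarith
  · have : ((l : ℕ) : ℝ) + 1 ≤ ((k : ℕ) : ℝ) := by exact_mod_cast h'
    rw [abs_of_nonneg] <;> linarith

/-- Matrices on which the two triangle slacks vanish only if the third does. -/
def K {n : ℕ} (i j k l : Fin n) : Set (Matrix (Fin n) (Fin n) ℝ) :=
  {X | 0 < (X i j + X j k - X i k) + (X j k + X k l - X j l) ∨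
    ((X i j + X j k - X i k) + (X j k + X k l - X j l) = 0 ∧ X i j + X j l - X i l = 0)}

lemma K_convex {n : ℕ} (i j k l : Fin n) : Convex ℝ (K i j k l) := by
  intro X hX Y hY a b ha hb hab
  rcases ha.eq_or_lt with rfl | ha
  · obtain rfl : b = 1 := by linarith
    simpa using hY
  rcases hb.eq_or_lt with rfl | hb
  · obtain rfl : a = 1 := by linarith
    simpa using hX
  simp only [K, Set.mem_ofPred_eq, Matrix.add_apply, Matrix.smul_apply, smul_eq_mul] at *
  rcases hX with hX | ⟨hX, hX'⟩ <;> rcases hY with hY | ⟨hY, hY'⟩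
  · left; nlinarith [mul_pos ha hX, mul_pos hb hY]
  · left; nlinarith [mul_pos ha hX, congrArg (b * ·) hY]
  · left; nlinarith [mul_pos hb hY, congrArg (a * ·) hX]
  · right
    constructor
    · linear_combination a * hX + b * hY
    · linear_combination a * hX' + b * hY'

lemma E_sub_K {n : ℕ} {i j k l : Fin n} (hjk : j ≠ k) : Ebn n ⊆ K i j k l := by
  rintro X ⟨x, hx, rfl⟩
  have h := hx j k hjk
  simp only [K, Set.mem_ofPred_eq, mmap]
  by_cases h0 : 0 < (|x i - x j| + |x j - x k| - |x i - x k|) +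
      (|x j - x k| + |x k - x l| - |x j - x l|)
  · exact Or.inl h0
  right
  have t1 := abs_sub_le (x i) (x j) (x k)
  have t2 := abs_sub_le (x j) (x k) (x l)
  refine ⟨by linarith, ?_⟩
  have e1 : |x i - x j| + |x j - x k| = |x i - x k| := by linarith
  have e2 : |x j - x k| + |x k - x l| = |x j - x l| := by linarith
  clear h0 t1 t2 hx
  have s1 : 0 ≤ (x i - x j) * (x j - x k) := by
    rw [show x i - x k = (x i - x j) + (x j - x k) by ring] at e1
    rcases abs_add_eq_add_abs_iff (x i - x j) (x j - x k) |>.1 e1.symm with ⟨a, b⟩ | ⟨a, b⟩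
    · exact mul_nonneg a b
    · exact mul_nonneg_of_nonpos_of_nonpos a b
  have s2 : 0 ≤ (x j - x k) * (x k - x l) := by
    rw [show x j - x l = (x j - x k) + (x k - x l) by ring] at e2
    rcases abs_add_eq_add_abs_iff (x j - x k) (x k - x l) |>.1 e2.symm with ⟨a, b⟩ | ⟨a, b⟩
    · exact mul_nonneg a b
    · exact mul_nonneg_of_nonpos_of_nonpos a b
  rcases le_abs.1 h with h | h
  · have a1 : 0 ≤ x i - x j := nonneg_of_mul_nonneg_left s1 (by linarith)
    have a2 : 0 ≤ x k - x l := nonneg_of_mul_nonneg_right s2 (by linarith)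
    rw [abs_of_nonneg a1, abs_of_nonneg (by linarith), abs_of_nonneg (by linarith)]
    ring
  · have a1 : x i - x j ≤ 0 := by nlinarith
    have a2 : x k - x l ≤ 0 := by nlinarith
    rw [abs_of_nonpos a1, abs_of_nonpos (by linarith), abs_of_nonpos (by linarith)]
    ring

lemma not_closed (n : ℕ) (hn : 4 ≤ n) : ¬ IsClosed (Qn n) := by
  intro hcl
  let d : Fin n → ℝ := fun j => ((j : ℕ) : ℝ)
  let U : Finset (Fin n) := {⟨1, by omega⟩, ⟨2, by omega⟩}
  let f : ℝ → Matrix (Fin n) (Fin n) ℝ := fun e => (1 - e) • mmap d + mmap (chi U + e • d)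
  have hf : Continuous f := by
    refine ((continuous_const.sub continuous_id).smul continuous_const).add ?_
    exact mmap_cont.comp (continuous_const.add (continuous_id.smul continuous_const))
  have hmem : ∀ e : ℝ, 0 < e → e < 1 / (n + 1) → f e ∈ Qn n := by
    intro e he he'
    have hn0 : (0 : ℝ) < n + 1 := by positivity
    have hen : e * (n + 1) < 1 := by rwa [lt_div_iff₀ hn0] at he'
    have he1 : e ≤ 1 := by nlinarith [(Nat.cast_nonneg n : (0 : ℝ) ≤ n)]
    have hconv : Convex ℝ (Qn n) := convex_convexHull ℝ _
    have m1 : mmap d ∈ Qn n := subset_convexHull ℝ _ ⟨d, fun k l h => idx_dist h, rfl⟩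
    have m2 : mmap (e⁻¹ • chi U + d) ∈ Qn n := by
      refine subset_convexHull ℝ _ ⟨_, fun k l h => ?_, rfl⟩
      have hE : (n : ℝ) + 1 ≤ e⁻¹ := by
        rw [← one_div, le_div_iff₀ he]; linarith
      have hk : d k ≤ n := by simpa [d] using k.2.le
      have hl : d l ≤ n := by simpa [d] using l.2.le
      have hk0 : 0 ≤ d k := by simp [d]
      have hl0 : 0 ≤ d l := by simp [d]
      have hd : 1 ≤ |d k - d l| := idx_dist h
      simp only [Pi.add_apply, Pi.smul_apply, smul_eq_mul, chi]
      split_ifs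
      · simpa using hd
      · rw [abs_of_nonneg] <;> linarith
      · rw [abs_of_nonpos] <;> linarith
      · simpa using hd
    have := hconv m1 m2 (a := 1 - e) (b := e) (by linarith) he.le (by ring)
    rw [← mmap_smul e he.le, smul_add, smul_smul, mul_inv_cancel₀ he.ne', one_smul] at this
    exact this
  have h0 : f 0 ∈ Qn n := by
    have ht : Filter.Tendsto f (nhdsWithin 0 (Set.Ioi 0)) (nhds (f 0)) :=
      hf.continuousAt.tendsto.mono_left nhdsWithin_le_nhds
    refine hcl.mem_of_tendsto ht ?_
    have hp : (0 : ℝ) < 1 / (n + 1) := by positivity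
    filter_upwards [Ioo_mem_nhdsGT hp] with e he
    exact hmem e he.1 he.2
  have hK : f 0 ∈ K (⟨0, by omega⟩ : Fin n) ⟨1, by omega⟩ ⟨2, by omega⟩ ⟨3, by omega⟩ :=
    convexHull_min (E_sub_K (by simp)) (K_convex _ _ _ _) h0
  simp [K, f, mmap, d, chi, U] at hK
  norm_num at hK

theorem stmt19 (n : ℕ) (hn : 3 ≤ n) : IsClosed (Qn n) ↔ n ≤ 3 := by
  constructor
  · intro h
    by_contra hlt
    exact not_closed n (by omega) h
  · intro h
    obtain rfl : n = 3 := by omega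
    rw [Q3_eq]
    exact P3_closed
end
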